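/- Let I be a (2,2)-E3-SAT instance and G_I the bipartite graph constructed from I. Then G_I admits a popular matching if and only if I is satisfiable. -/

import Mathlib

open Classical

noncomputable section

variable {A B : Type*}

/-- A matching in the bipartite graph `G = (A ∪ B, E)`, represented as a partial
function assigning to each applicant `a ∈ A` its partner post (if any). -/
def IsMatching (E : A → B → Prop) (M : A → Option B) : Prop :=
  (∀ a b, M a = some b → E a b) ∧ ∀ a a' b, M a = some b → M a' = some b → a = a'

/-- Post `b` is matched in `M`. -/
def PostMatched (M : A → Option B) (b : B) : Prop := ∃ a, M a = some b

/-- Applicant `a` prefers matching `M` to `M'` (lower rank = more preferred);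
an applicant prefers being matched to being unmatched. -/
def APrefers (rank : A → B → ℕ) (M M' : A → Option B) (a : A) : Prop :=
  match M a, M' a with
  | some _, none => True
  | some b, some b' => rank a b < rank a b'
  | none, _ => False

/-- In the model where each post puts all its neighbors into a single tie,
post `b` prefers `M` to `M'` iff it is matched in `M` and unmatched in `M'`. -/
def BPrefers (M M' : A → Option B) (b : B) : Prop :=
  PostMatched M b ∧ ¬ PostMatched M' b

/-- `phi rank M M'` is the number of vertices preferring `M` to `M'`
(both sides vote; posts have all neighbors in a single tie). -/
def phi (rank : A → B → ℕ) (M M' : A → Option B) : ℕ :=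
  Nat.card {a : A // APrefers rank M M' a} + Nat.card {b : B // BPrefers M M' b}

/-- `M` is a popular matching of `G` (two-sided votes, one-sided ties model). -/
def Popular (E : A → B → Prop) (rank : A → B → ℕ) (M : A → Option B) : Prop :=
  IsMatching E M ∧ ∀ M', IsMatching E M' → phi rank M' M ≤ phi rank M M'

/-- The applicants' preference lists are strict: distinct neighbors get distinct ranks. -/
def StrictRanks (E : A → B → Prop) (rank : A → B → ℕ) : Prop :=
  ∀ a b b', E a b → E a b' → rank a b = rank a b' → b = b'

/-- `f a` is applicant `a`'s top-ranked neighbor. -/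
def IsTopChoice (E : A → B → Prop) (rank : A → B → ℕ) (f : A → B) : Prop :=
  ∀ a, E a (f a) ∧ ∀ b, E a b → rank a (f a) ≤ rank a b

/-- Post `b` (with preference list `prank b`, possibly containing ties) prefers `M`
to `M'`: either matched in `M` and unmatched in `M'`, or matched in both to a
strictly better-ranked partner in `M`. -/
def BPrefersGen (prank : B → A → ℕ) (M M' : A → Option B) (b : B) : Prop :=
  (PostMatched M b ∧ ¬ PostMatched M' b) ∨
    ∃ a a', M a = some b ∧ M' a' = some b ∧ prank b a < prank b a'

/-- Number of vertices preferring `M` to `M'` when posts have general preference lists. -/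
def phiGen (rank : A → B → ℕ) (prank : B → A → ℕ) (M M' : A → Option B) : ℕ :=
  Nat.card {a : A // APrefers rank M M' a} +
    Nat.card {b : B // BPrefersGen prank M M' b}

/-- `M` is a popular matching (two-sided votes; posts have preference lists `prank`). -/
def PopularGen (E : A → B → Prop) (rank : A → B → ℕ) (prank : B → A → ℕ)
    (M : A → Option B) : Prop :=
  IsMatching E M ∧ ∀ M', IsMatching E M' →
    phiGen rank prank M' M ≤ phiGen rank prank M M'

/-! ## The (2,2)-E3-SAT construction

A (2,2)-E3-SAT instance with `n` variables and `m` clauses is given by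
`lit : Fin m → Fin 3 → Fin n × Bool`, where `lit i k = (j, s)` means that the
`k`-th literal of clause `C_i` is the variable `v_j`, unnegated if `s = true`
and negated if `s = false`. -/

/-- Every variable appears exactly twice unnegated and exactly twice negated. -/
def TwoTwo {n m : ℕ} (lit : Fin m → Fin 3 → Fin n × Bool) : Prop :=
  ∀ (j : Fin n) (s : Bool),
    (Finset.univ.filter fun p : Fin m × Fin 3 => lit p.1 p.2 = (j, s)).card = 2

/-- Applicants of `G_I`: `Sum.inl (j, true)` is `a_{j1}` (the unnegated side),
`Sum.inl (j, false)` is `a_{j2}` (the negated side), `Sum.inr (i, k)` is `x_{ik}`. -/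
abbrev AI (n m : ℕ) := (Fin n × Bool) ⊕ (Fin m × Fin 3)

/-- Posts of `G_I`: `Sum.inl (j, true)` is `b_{j1}`, `Sum.inl (j, false)` is `b_{j2}`,
`Sum.inr (Sum.inl i)` is `c_i`, and `Sum.inr (Sum.inr (i, k))` is `y_{ik}`. -/
abbrev BI (n m : ℕ) := (Fin n × Bool) ⊕ (Fin m ⊕ (Fin m × Fin 3))

/-- The edges of `G_I`: each variable gadget is a 4-cycle on `a_{j1}, a_{j2}, b_{j1}, b_{j2}`;
each `x_{ik}` is adjacent to `c_i` and to `y_{ik}`; and `y_{ik}` is joined by an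
interconnecting edge to `a_{j1}` (resp. `a_{j2}`) if the `k`-th literal of `C_i`
is `v_j` (resp. `¬ v_j`). -/
def EI {n m : ℕ} (lit : Fin m → Fin 3 → Fin n × Bool) : AI n m → BI n m → Prop
  | Sum.inl (j, _), Sum.inl (j', _) => j = j'
  | Sum.inl (j, t), Sum.inr (Sum.inr (i, k)) => lit i k = (j, t)
  | Sum.inl _, Sum.inr (Sum.inl _) => False
  | Sum.inr (i, _), Sum.inr (Sum.inl i') => i = i'
  | Sum.inr (i, k), Sum.inr (Sum.inr p) => p = (i, k)
  | Sum.inr _, Sum.inl _ => False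

/-- The number of occurrences of variable `j` with sign `t` occurring (in the fixed
lexicographic order on occurrences) strictly before the occurrence `(i, k)`;
used to order the two `y`-neighbors of `a_{jt}` in its preference list. -/
def occBefore {n m : ℕ} (lit : Fin m → Fin 3 → Fin n × Bool)
    (j : Fin n) (t : Bool) (i : Fin m) (k : Fin 3) : ℕ :=
  (Finset.univ.filter fun p : Fin m × Fin 3 =>
     lit p.1 p.2 = (j, t) ∧ (p.1 < i ∨ (p.1 = i ∧ p.2 < k))).card

/-- The applicants' (strict) preference lists of `G_I`, as a rank function
(lower rank = more preferred; the value on non-edges is irrelevant):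
`x_{ik}` ranks `c_i` first and `y_{ik}` second; `a_{jt}` ranks `b_{j1}` first,
its two interconnecting `y`-neighbors second and third (in a fixed order),
and `b_{j2}` fourth. -/
def rankI {n m : ℕ} (lit : Fin m → Fin 3 → Fin n × Bool) : AI n m → BI n m → ℕ
  | Sum.inl _, Sum.inl (_, s) => if s then 1 else 4
  | Sum.inl (j, t), Sum.inr (Sum.inr (i, k)) => 2 + occBefore lit j t i k
  | Sum.inl _, Sum.inr (Sum.inl _) => 0
  | Sum.inr _, Sum.inr (Sum.inl _) => 1
  | Sum.inr _, Sum.inr (Sum.inr _) => 2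
  | Sum.inr _, Sum.inl _ => 0

/-- The posts' preference lists of `G_I`: each `y_{ik}` ranks `x_{ik}` first and its
interconnecting `a`-neighbor second; each `c_i` puts its three neighbors
`x_{i1}, x_{i2}, x_{i3}` into a single tie, and each `b_{js}` puts its two neighbors
`a_{j1}, a_{j2}` into a single tie. -/
def prankI {n m : ℕ} : BI n m → AI n m → ℕ
  | Sum.inr (Sum.inr _), Sum.inr _ => 1
  | Sum.inr (Sum.inr _), Sum.inl _ => 2
  | _, _ => 1

/-- The matching built from a satisfying assignment `σ` together with a choice
`choice i` of a true literal in each clause `C_i`: if `σ v_j` is true take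
`(a_{j1}, b_{j1}), (a_{j2}, b_{j2})`, otherwise `(a_{j1}, b_{j2}), (a_{j2}, b_{j1})`;
in clause `C_i`, `x_{i,choice i}` is matched to `c_i`, the other two `x_{ik}` to their
`y_{ik}`, and `y_{i,choice i}` is left unmatched. No interconnecting edge is used. -/
def Msat {n m : ℕ} (σ : Fin n → Bool) (choice : Fin m → Fin 3) :
    AI n m → Option (BI n m)
  | Sum.inl (j, t) => some (Sum.inl (j, t == σ j))
  | Sum.inr (i, k) =>
      if k = choice i then some (Sum.inr (Sum.inl i))
      else some (Sum.inr (Sum.inr (i, k)))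

section Voting

variable {E : A → B → Prop} {rank : A → B → ℕ} {prank : B → A → ℕ} {M M' : A → Option B}

/-- Moving `a` to a post that no other applicant holds keeps a matching a matching. -/
theorem IsMatching.update [DecidableEq A] (h : IsMatching E M) {a : A} {b : B} (hE : E a b)
    (hb : ∀ a', M a' = some b → a' = a) : IsMatching E (Function.update M a (some b)) := by
  refine ⟨fun a' b' h' => ?_, fun a₁ a₂ b' h₁ h₂ => ?_⟩
  · have := h.1 a' b'
    simp only [Function.update_apply] at h'
    grind
  · have := h.2 a₁ a₂ b'
    simp only [Function.update_apply] at h₁ h₂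
    grind

/-- Leaving `a` unmatched keeps a matching a matching. -/
theorem IsMatching.update_none [DecidableEq A] (h : IsMatching E M) (a : A) :
    IsMatching E (Function.update M a none) := by
  refine ⟨fun a' b' h' => ?_, fun a₁ a₂ b' h₁ h₂ => ?_⟩
  · have := h.1 a' b'
    simp only [Function.update_apply] at h'
    grind
  · have := h.2 a₁ a₂ b'
    simp only [Function.update_apply] at h₁ h₂
    grind

theorem card_le_natCard_subtype {α : Type*} [Finite α] {P : α → Prop} {S : Finset α}
    (h : ∀ x ∈ S, P x) : S.card ≤ Nat.card {x // P x} := by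
  have := Fintype.ofFinite α
  rw [Nat.card_eq_fintype_card, Fintype.card_subtype]
  exact Finset.card_le_card fun x hx => by simpa using h x hx

theorem natCard_subtype_le_card {α : Type*} [Finite α] {P : α → Prop} {S : Finset α}
    (h : ∀ x, P x → x ∈ S) : Nat.card {x // P x} ≤ S.card := by
  have := Fintype.ofFinite α
  rw [Nat.card_eq_fintype_card, Fintype.card_subtype]
  exact Finset.card_le_card fun x hx => h x (by simpa using hx)

/-- Against a popular matching, certain winners never outnumber the possible losers. -/
theorem PopularGen.card_le [Finite A] [Finite B] (h : PopularGen E rank prank M)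
    (h' : IsMatching E M') {S T : Finset A} {S' T' : Finset B}
    (hS : ∀ a ∈ S, APrefers rank M' M a) (hT : ∀ a, APrefers rank M M' a → a ∈ T)
    (hS' : ∀ b ∈ S', BPrefersGen prank M' M b) (hT' : ∀ b, BPrefersGen prank M M' b → b ∈ T') :
    S.card + S'.card ≤ T.card + T'.card :=
  calc S.card + S'.card ≤ phiGen rank prank M' M :=
        Nat.add_le_add (card_le_natCard_subtype hS) (card_le_natCard_subtype hS')
    _ ≤ phiGen rank prank M M' := h.2 M' h'
    _ ≤ T.card + T'.card :=
        Nat.add_le_add (natCard_subtype_le_card hT) (natCard_subtype_le_card hT')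

/-- In a popular matching no applicant prefers an unmatched neighbor to her own partner. -/
theorem PopularGen.exists_rank_le [Finite A] [Finite B] (h : PopularGen E rank prank M)
    {a : A} {b : B} (hE : E a b) (hb : ¬ PostMatched M b) :
    ∃ b', M a = some b' ∧ rank a b' ≤ rank a b := by
  by_contra! hlt
  have key := h.card_le (S := {a}) (T := ∅) (S' := {b}) (T' := (M a).toFinset)
    (h.1.update hE fun a' ha' => (hb ⟨a', ha'⟩).elim) ?_ ?_ ?_ ?_
  · have : (M a).toFinset.card ≤ 1 := by cases M a <;> simp
    simp only [Finset.card_singleton, Finset.card_empty] at key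
    omega
  · intro a' ha'
    obtain rfl := Finset.mem_singleton.1 ha'
    simp only [APrefers, Function.update_self]
    split <;> grind
  · intro a' ha'
    by_cases haa : a' = a
    · subst haa
      simp only [APrefers, Function.update_self] at ha'
      split at ha' <;> grind
    · simp only [APrefers, Function.update_of_ne haa] at ha'
      split at ha' <;> grind
  · intro b' hb'
    obtain rfl := Finset.mem_singleton.1 hb'
    exact Or.inl ⟨⟨a, by simp⟩, hb⟩
  · rintro b' (⟨⟨a', ha'⟩, hn⟩ | ⟨a₁, a₂, h₁, h₂, hlt'⟩)
    · by_cases haa : a' = a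
      · simp [← haa, ha']
      · exact (hn ⟨a', by rwa [Function.update_of_ne haa]⟩).elim
    · by_cases haa : a₂ = a
      · subst haa
        rw [Function.update_self, Option.some.injEq] at h₂
        exact (hb ⟨a₁, h₂ ▸ h₁⟩).elim
      · rw [Function.update_of_ne haa] at h₂
        rw [h.1.2 _ _ _ h₁ h₂] at hlt'
        exact (lt_irrefl _ hlt').elim

/-- In a popular matching no post prefers an unmatched neighbor to its own partner. -/
theorem PopularGen.prank_le [Finite A] [Finite B] (h : PopularGen E rank prank M)
    {a x : A} {b : B} (hE : E x b) (hx : M x = none) (ha : M a = some b) :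
    prank b a ≤ prank b x := by
  by_contra! hlt
  have hne : x ≠ a := by rintro rfl; simp [hx] at ha
  have key := h.card_le (S := {x}) (T := {a}) (S' := {b}) (T' := ∅)
    ((h.1.update_none a).update (a := x) hE fun a' ha' => ?_) ?_ ?_ ?_ ?_
  · simp at key
  · by_cases haa : a' = a
    · simp [haa] at ha'
    · rw [Function.update_of_ne haa] at ha'
      exact (haa (h.1.2 _ _ _ ha' ha)).elim
  · intro a' ha'
    obtain rfl := Finset.mem_singleton.1 ha'
    simp [APrefers, hx]
  · intro a' ha'
    by_contra hna
    rw [Finset.mem_singleton] at hna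
    by_cases hax : a' = x
    · simp [APrefers, hax, hx] at ha'
    · simp only [APrefers, Function.update_of_ne hax, Function.update_of_ne hna] at ha'
      split at ha' <;> grind
  · intro b' hb'
    obtain rfl := Finset.mem_singleton.1 hb'
    exact Or.inr ⟨x, a, by simp, ha, hlt⟩
  · rintro b' (⟨⟨a', ha'⟩, hn⟩ | ⟨a₁, a₂, h₁, h₂, hlt'⟩)
    · by_cases haa : a' = a
      · subst haa
        obtain rfl : b' = b := by simpa [ha'] using ha
        exact (hn ⟨x, by simp⟩).elim
      · have hax : a' ≠ x := by rintro rfl; simp [hx] at ha'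
        exact (hn ⟨a', by rwa [Function.update_of_ne hax, Function.update_of_ne haa]⟩).elim
    · by_cases hax : a₂ = x
      · subst hax
        rw [Function.update_self, Option.some.injEq] at h₂
        subst h₂
        rw [h.1.2 _ _ _ h₁ ha] at hlt'
        omega
      · rw [Function.update_of_ne hax] at h₂
        by_cases haa : a₂ = a
        · simp [haa] at h₂
        · rw [Function.update_of_ne haa] at h₂
          rw [h.1.2 _ _ _ h₁ h₂] at hlt'
          exact (lt_irrefl _ hlt').elim

/-- A function on the vertices has nonpositive total if it is nonpositive on every edge of a
matching and on every vertex the matching leaves out. -/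
theorem IsMatching.sum_add_sum_nonpos [Fintype A] [Fintype B] (h : IsMatching E M)
    {f : A → ℤ} {g : B → ℤ} (hf : ∀ a, M a = none → f a ≤ 0)
    (hg : ∀ b, ¬ PostMatched M b → g b ≤ 0) (hfg : ∀ a b, M a = some b → f a + g b ≤ 0) :
    ∑ a, f a + ∑ b, g b ≤ 0 := by
  have hB : ∑ b, g b ≤ ∑ b, ∑ a, if M a = some b then g b else 0 := by
    refine Finset.sum_le_sum fun b _ => ?_
    by_cases hb : PostMatched M b
    · obtain ⟨a, ha⟩ := hb
      rw [Finset.sum_eq_single a (fun a' _ ha' => if_neg fun h' => ha' (h.2 _ _ _ h' ha))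
        (by simp), if_pos ha]
    · rw [Finset.sum_eq_zero fun a _ => if_neg fun h' => hb ⟨a, h'⟩]
      exact hg b hb
  rw [Finset.sum_comm] at hB
  have hA : ∑ a, (f a + ∑ b, if M a = some b then g b else 0) ≤ 0 := by
    refine Finset.sum_nonpos fun a _ => ?_
    cases ha : M a with
    | none => simpa using hf a ha
    | some b => simpa using hfg a b ha
  rw [Finset.sum_add_distrib] at hA
  omega

theorem natCard_subtype_eq_sum {α : Type*} [Fintype α] (P : α → Prop) :
    (Nat.card {x // P x} : ℤ) = ∑ x, if P x then 1 else 0 := by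
  rw [Nat.card_eq_fintype_card, Fintype.card_subtype, Finset.card_filter]
  push_cast
  rfl

/-- The vote of applicant `a` for `M'` against `M`. -/
def voteA (rank : A → B → ℕ) (M' M : A → Option B) (a : A) : ℤ :=
  (if APrefers rank M' M a then 1 else 0) - if APrefers rank M M' a then 1 else 0

/-- The vote of post `b` for `M'` against `M`. -/
def voteB (prank : B → A → ℕ) (M' M : A → Option B) (b : B) : ℤ :=
  (if BPrefersGen prank M' M b then 1 else 0) - if BPrefersGen prank M M' b then 1 else 0

theorem voteB_le_one (b : B) : voteB prank M' M b ≤ 1 := by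
  unfold voteB; split_ifs <;> simp

/-- A dual certificate of total weight zero witnesses popularity. -/
theorem popularGen_of_weights [Fintype A] [Fintype B] (hM : IsMatching E M)
    (α : A → ℤ) (β : B → ℤ) (hsum : ∑ a, α a + ∑ b, β b = 0)
    (hα : ∀ M', IsMatching E M' → ∀ a, M' a = none → voteA rank M' M a ≤ α a)
    (hβ : ∀ M', IsMatching E M' → ∀ b, ¬ PostMatched M' b → voteB prank M' M b ≤ β b)
    (hαβ : ∀ M', IsMatching E M' → ∀ a b, M' a = some b →
      voteA rank M' M a + voteB prank M' M b ≤ α a + β b) :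
    PopularGen E rank prank M := by
  refine ⟨hM, fun M' hM' => ?_⟩
  have key := hM'.sum_add_sum_nonpos (f := fun a => voteA rank M' M a - α a)
    (g := fun b => voteB prank M' M b - β b)
    (fun a ha => sub_nonpos.2 (hα M' hM' a ha)) (fun b hb => sub_nonpos.2 (hβ M' hM' b hb))
    (fun a b hab => by linarith [hαβ M' hM' a b hab])
  simp only [voteA, voteB, Finset.sum_sub_distrib, ← natCard_subtype_eq_sum] at key
  unfold phiGen
  omega

theorem voteA_eq_of_some {a : A} {b b' : B} (h' : M' a = some b') (h : M a = some b) :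
    voteA rank M' M a = (if rank a b' < rank a b then 1 else 0) -
      if rank a b < rank a b' then 1 else 0 := by
  simp [voteA, APrefers, h, h']

theorem voteA_eq_of_none {a : A} {b : B} (h' : M' a = none) (h : M a = some b) :
    voteA rank M' M a = -1 := by
  simp [voteA, APrefers, h, h']

theorem voteB_eq_of_matched (hM' : IsMatching E M') (hM : IsMatching E M) {a a' : A} {b : B}
    (h' : M' a' = some b) (h : M a = some b) :
    voteB prank M' M b = (if prank b a' < prank b a then 1 else 0) -
      if prank b a < prank b a' then 1 else 0 := by
  have e₁ : BPrefersGen prank M' M b ↔ prank b a' < prank b a := by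
    refine ⟨?_, fun hlt => Or.inr ⟨a', a, h', h, hlt⟩⟩
    rintro (⟨-, hn⟩ | ⟨a₁, a₂, h₁, h₂, hlt⟩)
    · exact (hn ⟨a, h⟩).elim
    · rwa [hM'.2 _ _ _ h' h₁, hM.2 _ _ _ h h₂]
  have e₂ : BPrefersGen prank M M' b ↔ prank b a < prank b a' := by
    refine ⟨?_, fun hlt => Or.inr ⟨a, a', h, h', hlt⟩⟩
    rintro (⟨-, hn⟩ | ⟨a₁, a₂, h₁, h₂, hlt⟩)
    · exact (hn ⟨a', h'⟩).elim
    · rwa [hM'.2 _ _ _ h' h₂, hM.2 _ _ _ h h₁]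
  simp only [voteB, e₁, e₂]

theorem voteB_eq_of_lost (hb' : ¬ PostMatched M' b) (hb : PostMatched M b) :
    voteB prank M' M b = -1 := by
  have e₁ : ¬ BPrefersGen prank M' M b := by
    rintro (⟨hn, -⟩ | ⟨a₁, a₂, h₁, h₂, hlt⟩)
    · exact hb' hn
    · exact hb' ⟨a₁, h₁⟩
  have e₂ : BPrefersGen prank M M' b := Or.inl ⟨hb, hb'⟩
  simp [voteB, e₁, e₂]

theorem voteB_eq_zero_of_unmatched (hb' : ¬ PostMatched M' b) (hb : ¬ PostMatched M b) :
    voteB prank M' M b = 0 := by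
  have e₁ : ¬ BPrefersGen prank M' M b := by
    rintro (⟨hn, -⟩ | ⟨a₁, a₂, h₁, h₂, hlt⟩)
    · exact hb' hn
    · exact hb' ⟨a₁, h₁⟩
  have e₂ : ¬ BPrefersGen prank M M' b := by
    rintro (⟨hn, -⟩ | ⟨a₁, a₂, h₁, h₂, hlt⟩)
    · exact hb hn
    · exact hb ⟨a₁, h₁⟩
  simp [voteB, e₁, e₂]

end Voting

section Gadget

variable {n m : ℕ} {lit : Fin m → Fin 3 → Fin n × Bool}

theorem isMatching_Msat (σ : Fin n → Bool) (choice : Fin m → Fin 3) :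
    IsMatching (EI lit) (Msat σ choice) := by
  refine ⟨?_, ?_⟩
  · rintro (⟨j, t⟩ | ⟨i, k⟩) b h
    · simp only [Msat, Option.some.injEq] at h
      subst h
      simp [EI]
    · simp only [Msat] at h
      split_ifs at h <;> (simp only [Option.some.injEq] at h; subst h; simp [EI])
  · rintro (⟨j, t⟩ | ⟨i, k⟩) (⟨j', t'⟩ | ⟨i', k'⟩) b h h'
    · simp only [Msat, Option.some.injEq] at h h'
      subst h
      simp only [Sum.inl.injEq, Prod.mk.injEq] at h' ⊢
      obtain ⟨rfl, h'⟩ := h'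
      revert h'
      cases t <;> cases t' <;> cases σ j' <;> simp
    · simp only [Msat] at h h'
      split_ifs at h' <;> cases h <;> simp at h'
    · simp only [Msat] at h h'
      split_ifs at h <;> cases h' <;> simp at h
    · simp only [Msat] at h h'
      split_ifs at h h' <;> grind

theorem Msat_inl (σ : Fin n → Bool) (choice : Fin m → Fin 3) (j : Fin n) (s : Bool) :
    Msat σ choice (Sum.inl (j, s == σ j)) = some (Sum.inl (j, s)) := by
  cases s <;> cases h : σ j <;> simp [Msat, h]

theorem Msat_choice (σ : Fin n → Bool) (choice : Fin m → Fin 3) (i : Fin m) :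
    Msat σ choice (Sum.inr (i, choice i)) = some (Sum.inr (Sum.inl i)) := by
  simp [Msat]

theorem Msat_of_ne (σ : Fin n → Bool) {choice : Fin m → Fin 3} {i : Fin m} {k : Fin 3}
    (h : k ≠ choice i) :
    Msat σ choice (Sum.inr (i, k)) = some (Sum.inr (Sum.inr (i, k))) := by
  simp [Msat, h]

theorem not_postMatched_Msat (σ : Fin n → Bool) (choice : Fin m → Fin 3) (i : Fin m) :
    ¬ PostMatched (Msat σ choice) (Sum.inr (Sum.inr (i, choice i))) := by
  rintro ⟨⟨j, t⟩ | ⟨i', k'⟩, h⟩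
  · simp [Msat] at h
  · simp only [Msat] at h
    split_ifs at h <;> grind

theorem occBefore_lt_two (htwo : TwoTwo lit) {j : Fin n} {t : Bool} {i : Fin m} {k : Fin 3}
    (h : lit i k = (j, t)) : occBefore lit j t i k < 2 := by
  rw [← htwo j t]
  refine Finset.card_lt_card ⟨fun p => ?_, fun hsub => ?_⟩
  · simp +contextual
  · have := @hsub (i, k) (by simp [h])
    simp at this

/-- The dual weights of the applicants certifying that `Msat` is popular. -/
def weightA (σ : Fin n → Bool) (choice : Fin m → Fin 3) : AI n m → ℤ
  | Sum.inl (j, t) => if t = σ j then 0 else 1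
  | Sum.inr (i, k) => if k = choice i then 0 else 1

/-- The dual weights of the posts certifying that `Msat` is popular. -/
def weightB (choice : Fin m → Fin 3) : BI n m → ℤ
  | Sum.inl (_, s) => if s then 0 else -1
  | Sum.inr (Sum.inl _) => 0
  | Sum.inr (Sum.inr (i, k)) => if k = choice i then 0 else -1

theorem sum_weights (σ : Fin n → Bool) (choice : Fin m → Fin 3) :
    ∑ a, weightA σ choice a + ∑ b : BI n m, weightB choice b = 0 := by
  have h₁ : ∑ p : Fin n × Bool,
      ((if p.2 = σ p.1 then 0 else 1 : ℤ) + if p.2 then 0 else -1) = 0 := by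
    rw [Fintype.sum_prod_type]
    refine Finset.sum_eq_zero fun j _ => ?_
    cases h : σ j <;> simp [h]
  have h₂ : ∑ p : Fin m × Fin 3,
      ((if p.2 = choice p.1 then 0 else 1 : ℤ) + if p.2 = choice p.1 then 0 else -1) = 0 :=
    Finset.sum_eq_zero fun p _ => by split_ifs <;> simp
  rw [Finset.sum_add_distrib] at h₁ h₂
  simp only [Fintype.sum_sum_type, weightA, weightB, Finset.sum_const_zero]
  linarith

theorem popularGen_Msat (htwo : TwoTwo lit) {σ : Fin n → Bool} {choice : Fin m → Fin 3}
    (hσ : ∀ i, σ (lit i (choice i)).1 = (lit i (choice i)).2) :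
    PopularGen (EI lit) (rankI lit) prankI (Msat σ choice) := by
  have hM := isMatching_Msat (lit := lit) σ choice
  refine popularGen_of_weights hM (weightA σ choice) (weightB choice) (sum_weights σ choice)
    ?_ ?_ ?_
  · rintro M' - (⟨j, t⟩ | ⟨i, k⟩) h
    · rw [voteA_eq_of_none h rfl, weightA]
      split_ifs <;> simp
    · by_cases hk : k = choice i
      · subst hk
        rw [voteA_eq_of_none h (Msat_choice σ choice i), weightA]
        simp
      · rw [voteA_eq_of_none h (Msat_of_ne σ hk), weightA]
        simp [hk]
  · rintro M' - (⟨j, s⟩ | i | ⟨i, k⟩) h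
    · rw [voteB_eq_of_lost h ⟨_, Msat_inl σ choice j s⟩, weightB]
      split_ifs <;> simp
    · rw [voteB_eq_of_lost h ⟨_, Msat_choice σ choice i⟩, weightB]
      simp
    · by_cases hk : k = choice i
      · subst hk
        rw [voteB_eq_zero_of_unmatched h (not_postMatched_Msat σ choice i), weightB]
        simp
      · rw [voteB_eq_of_lost h ⟨_, Msat_of_ne σ hk⟩, weightB]
        simp [hk]
  · rintro M' hM' (⟨j, t⟩ | ⟨i, k⟩) (⟨j', s⟩ | i' | ⟨i', k'⟩) h
    · obtain rfl : j = j' := hM'.1 _ _ h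
      rw [voteA_eq_of_some h (b := Sum.inl (j, t == σ j)) rfl,
        voteB_eq_of_matched hM' hM h (Msat_inl σ choice j s)]
      cases t <;> cases s <;> cases hj : σ j <;> simp [rankI, prankI, weightA, weightB, hj]
    · exact (hM'.1 _ _ h).elim
    · have hl : lit i' k' = (j, t) := hM'.1 _ _ h
      have hocc := occBefore_lt_two htwo hl
      rw [voteA_eq_of_some h (b := Sum.inl (j, t == σ j)) rfl]
      by_cases hk : k' = choice i'
      · subst hk
        have ht := hσ i'
        rw [hl] at ht
        have := voteB_le_one (prank := prankI) (M' := M') (M := Msat σ choice)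
          (Sum.inr (Sum.inr (i', choice i')))
        simp only [rankI, weightA, weightB, ht]
        simp
        omega
      · rw [voteB_eq_of_matched hM' hM h (Msat_of_ne σ hk)]
        cases t <;> cases hj : σ j <;>
          simp [rankI, prankI, weightA, weightB, hj, hk] <;> split_ifs <;> omega
    · exact (hM'.1 _ _ h).elim
    · obtain rfl : i = i' := hM'.1 _ _ h
      rw [voteB_eq_of_matched hM' hM h (Msat_choice σ choice i)]
      by_cases hk : k = choice i
      · subst hk
        rw [voteA_eq_of_some h (Msat_choice σ choice i)]
        simp [prankI, weightA, weightB]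
      · rw [voteA_eq_of_some h (Msat_of_ne σ hk)]
        simp [rankI, prankI, weightA, weightB, hk]
    · obtain ⟨rfl, rfl⟩ : i' = i ∧ k' = k := Prod.mk.injEq .. ▸ (hM'.1 _ _ h)
      by_cases hk : k' = choice i'
      · subst hk
        have := voteB_le_one (prank := prankI) (M' := M') (M := Msat σ choice)
          (Sum.inr (Sum.inr (i', choice i')))
        rw [voteA_eq_of_some h (Msat_choice σ choice i')]
        simp [rankI, weightA, weightB]
        omega
      · rw [voteA_eq_of_some h (Msat_of_ne σ hk),
          voteB_eq_of_matched hM' hM h (Msat_of_ne σ hk)]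
        simp [weightA, weightB, hk]

section Popular

variable {M : AI n m → Option (BI n m)} (h : PopularGen (EI lit) (rankI lit) prankI M)
include h

theorem PopularGen.exists_match_clause (i : Fin m) :
    ∃ k, M (Sum.inr (i, k)) = some (Sum.inr (Sum.inl i)) := by
  by_contra! hn
  have hfree : ¬ PostMatched M (Sum.inr (Sum.inl i)) := by
    rintro ⟨⟨j, t⟩ | ⟨i', k⟩, ha⟩
    · exact h.1.1 _ _ ha
    · obtain rfl : i' = i := h.1.1 _ _ ha
      exact hn k ha
  obtain ⟨b, hb, hle⟩ := h.exists_rank_le (a := Sum.inr (i, 0)) (b := Sum.inr (Sum.inl i)) rfl hfree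
  have hE := h.1.1 _ _ hb
  rcases b with b | i' | p
  · exact hE
  · obtain rfl : i = i' := hE
    exact hn 0 hb
  · simp [rankI] at hle

/-- A popular matching uses no interconnecting edge. -/
theorem PopularGen.not_interconnecting (j : Fin n) (t : Bool) (i : Fin m) (k : Fin 3) :
    M (Sum.inl (j, t)) ≠ some (Sum.inr (Sum.inr (i, k))) := by
  intro ha
  have hlit : lit i k = (j, t) := h.1.1 _ _ ha
  have hx : M (Sum.inr (i, k)) = some (Sum.inr (Sum.inl i)) := by
    cases hb : M (Sum.inr (i, k)) with
    | none =>
      have := h.prank_le (x := Sum.inr (i, k)) (b := Sum.inr (Sum.inr (i, k))) rfl hb ha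
      simp [prankI] at this
    | some b =>
      have hE := h.1.1 _ _ hb
      rcases b with b | i' | p
      · exact hE.elim
      · obtain rfl : i = i' := hE
        rfl
      · obtain rfl : p = (i, k) := hE
        have := h.1.2 _ _ _ ha hb
        simp at this
  have ha' : M (Sum.inl (j, !t)) = some (Sum.inl (j, true)) := by
    by_contra hn
    obtain ⟨b, hb, hle⟩ := h.exists_rank_le (a := Sum.inl (j, t)) (b := Sum.inl (j, true)) rfl (by
      rintro ⟨⟨j', t'⟩ | p, hm⟩
      · obtain rfl : j' = j := h.1.1 _ _ hm
        by_cases htt : t' = t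
        · subst htt
          simp [ha] at hm
        · rw [show t' = !t by cases t <;> cases t' <;> simp_all] at hm
          exact hn hm
      · exact h.1.1 _ _ hm)
    rw [ha] at hb
    obtain rfl := Option.some.inj hb
    simp [rankI] at hle
    omega
  have hb₂ : ∀ a, M a ≠ some (Sum.inl (j, false)) := by
    rintro (⟨j', t'⟩ | p) hm
    · obtain rfl : j' = j := h.1.1 _ _ hm
      by_cases htt : t' = t
      · subst htt
        simp [ha] at hm
      · rw [show t' = !t by cases t <;> cases t' <;> simp_all] at hm
        simp [ha'] at hm
    · exact h.1.1 _ _ hm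
  obtain ⟨k₂, hk₂⟩ : ∃ k₂ : Fin 3, k₂ ≠ k := exists_ne k
  set M' : AI n m → Option (BI n m) :=
    Function.update (Function.update (Function.update (Function.update M
      (Sum.inl (j, !t)) (some (Sum.inl (j, false))))
      (Sum.inl (j, t)) (some (Sum.inl (j, true))))
      (Sum.inr (i, k)) (some (Sum.inr (Sum.inr (i, k)))))
      (Sum.inr (i, k₂)) (some (Sum.inr (Sum.inl i))) with hM'
  have hx₂' : M' (Sum.inr (i, k₂)) = some (Sum.inr (Sum.inl i)) := by simp [hM']
  have hx' : M' (Sum.inr (i, k)) = some (Sum.inr (Sum.inr (i, k))) := by simp [hM', hk₂.symm]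
  have haT : M' (Sum.inl (j, t)) = some (Sum.inl (j, true)) := by simp [hM']
  have haF : M' (Sum.inl (j, !t)) = some (Sum.inl (j, false)) := by
    simp [hM']
  have hother : ∀ a, a ≠ Sum.inr (i, k₂) → a ≠ Sum.inr (i, k) → a ≠ Sum.inl (j, t) →
      a ≠ Sum.inl (j, !t) → M' a = M a := by
    intro a h₁ h₂ h₃ h₄
    simp [hM', h₁, h₂, h₃, h₄]
  have hx₂ : ∀ b, M (Sum.inr (i, k₂)) = some b → b = Sum.inr (Sum.inr (i, k₂)) := by
    intro b hb
    have hE := h.1.1 _ _ hb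
    rcases b with b | i' | p
    · exact hE.elim
    · obtain rfl : i = i' := hE
      have := h.1.2 _ _ _ hb hx
      simp [hk₂] at this
    · obtain rfl : p = (i, k₂) := hE
      rfl
  clear_value M'
  have hmatch : IsMatching (EI lit) M' := by
    refine hM' ▸ (((h.1.update (a := Sum.inl (j, !t)) (b := Sum.inl (j, false)) rfl
      fun a hm => (hb₂ a hm).elim).update
      (a := Sum.inl (j, t)) (b := Sum.inl (j, true)) rfl fun a hm => ?_).update
      (a := Sum.inr (i, k)) (b := Sum.inr (Sum.inr (i, k))) rfl fun a hm => ?_).update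
      (a := Sum.inr (i, k₂)) (b := Sum.inr (Sum.inl i)) rfl fun a hm => ?_
    all_goals
      have e₁ := h.1.2 _ a _ ha
      have e₂ := h.1.2 _ a _ ha'
      have e₃ := h.1.2 _ a _ hx
      simp only [Function.update_apply] at hm
      grind
  have key := h.card_le hmatch (S := {Sum.inr (i, k₂), Sum.inl (j, t)})
    (T := {Sum.inr (i, k), Sum.inl (j, !t)})
    (S' := {Sum.inr (Sum.inr (i, k)), Sum.inl (j, false)})
    (T' := {Sum.inr (Sum.inr (i, k₂))}) ?_ ?_ ?_ ?_
  · rw [Finset.card_pair (by simp), Finset.card_pair (by simp), Finset.card_pair (by simp),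
      Finset.card_singleton] at key
    omega
  · intro a hmem
    rw [Finset.mem_insert, Finset.mem_singleton] at hmem
    obtain rfl | rfl := hmem
    · cases hb : M (Sum.inr (i, k₂)) with
      | none => simp [APrefers, hx₂', hb]
      | some b =>
        obtain rfl := hx₂ b hb
        simp [APrefers, hx₂', hb, rankI]
    · simp [APrefers, haT, ha, rankI]
      omega
  · intro a hp
    by_contra hmem
    rw [Finset.mem_insert, Finset.mem_singleton, not_or] at hmem
    by_cases h₁ : a = Sum.inr (i, k₂)
    · subst h₁
      cases hb : M (Sum.inr (i, k₂)) with
      | none => simp [APrefers, hb] at hp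
      | some b =>
        obtain rfl := hx₂ b hb
        simp [APrefers, hx₂', hb, rankI] at hp
    by_cases h₂ : a = Sum.inl (j, t)
    · subst h₂
      simp [APrefers, haT, ha, rankI] at hp
    · rw [APrefers, hother a h₁ hmem.1 h₂ hmem.2] at hp
      split at hp <;> grind
  · intro b hmem
    rw [Finset.mem_insert, Finset.mem_singleton] at hmem
    obtain rfl | rfl := hmem
    · exact Or.inr ⟨_, _, hx', ha, by simp [prankI]⟩
    · exact Or.inl ⟨⟨_, haF⟩, fun ⟨a, hm⟩ => hb₂ a hm⟩
  · intro b hp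
    rw [Finset.mem_singleton]
    obtain ⟨⟨a, hm⟩, hn⟩ | ⟨a₁, a₂, h₁, h₂, hlt⟩ := hp
    · have hn' : ∀ a, M' a ≠ some b := fun a hb => hn ⟨a, hb⟩
      by_cases h₁ : a = Sum.inr (i, k₂)
      · exact hx₂ b (h₁ ▸ hm)
      by_cases h₂ : a = Sum.inr (i, k)
      · exact (hn' _ (by rw [hx₂', ← hx, ← h₂, hm])).elim
      by_cases h₃ : a = Sum.inl (j, t)
      · exact (hn' _ (by rw [hx', ← ha, ← h₃, hm])).elim
      by_cases h₄ : a = Sum.inl (j, !t)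
      · exact (hn' _ (by rw [haT, ← ha', ← h₄, hm])).elim
      · exact (hn' a (by rw [hother a h₁ h₂ h₃ h₄, hm])).elim
    · rcases b with b | i' | p
      · simp [prankI] at hlt
      · simp [prankI] at hlt
      · by_cases hc : a₂ = Sum.inr (i, k)
        · subst hc
          rw [hx'] at h₂
          simp only [Option.some.injEq, Sum.inr.injEq] at h₂
          subst h₂
          rw [h.1.2 _ _ _ h₁ ha] at hlt
          simp [prankI] at hlt
        · by_cases hc₁ : a₂ = Sum.inr (i, k₂)
          · simp [hc₁, hx₂'] at h₂
          by_cases hc₂ : a₂ = Sum.inl (j, t)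
          · simp [hc₂, haT] at h₂
          by_cases hc₃ : a₂ = Sum.inl (j, !t)
          · simp [hc₃, haF] at h₂
          rw [hother a₂ hc₁ hc hc₂ hc₃] at h₂
          rw [h.1.2 _ _ _ h₁ h₂] at hlt
          exact (lt_irrefl _ hlt).elim

theorem PopularGen.exists_satisfying (htwo : TwoTwo lit) :
    ∃ σ : Fin n → Bool, ∀ i, ∃ k, σ (lit i k).1 = (lit i k).2 := by
  refine ⟨fun j => decide (M (Sum.inl (j, true)) = some (Sum.inl (j, true))), fun i => ?_⟩
  obtain ⟨k, hk⟩ := h.exists_match_clause i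
  refine ⟨k, ?_⟩
  obtain ⟨⟨j, t⟩, hl⟩ : ∃ p, lit i k = p := ⟨_, rfl⟩
  rw [hl]
  have hfree : ¬ PostMatched M (Sum.inr (Sum.inr (i, k))) := by
    rintro ⟨⟨j', t'⟩ | p, hm⟩
    · exact h.not_interconnecting _ _ _ _ hm
    · obtain rfl : (i, k) = p := h.1.1 _ _ hm
      simp [hk] at hm
  obtain ⟨b, hb, hle⟩ := h.exists_rank_le (a := Sum.inl (j, t)) (b := Sum.inr (Sum.inr (i, k)))
    hl hfree
  have htop : M (Sum.inl (j, t)) = some (Sum.inl (j, true)) := by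
    have hE := h.1.1 _ _ hb
    rcases b with ⟨j', s⟩ | i' | ⟨i', k'⟩
    · obtain rfl : j = j' := hE
      have := occBefore_lt_two htwo hl
      cases s
      · simp [rankI] at hle
        omega
      · exact hb
    · exact hE.elim
    · exact (h.not_interconnecting _ _ _ _ hb).elim
  cases t
  · simp only [decide_eq_false_iff_not]
    intro hm
    have := h.1.2 _ _ _ hm htop
    simp at this
  · simpa using htop

end Popular

end Gadget

/-- `G_I` admits a popular matching iff the (2,2)-E3-SAT instance `I`
is satisfiable. -/
theorem popular_iff_satisfiable (n m : ℕ) (lit : Fin m → Fin 3 → Fin n × Bool)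
    (htwo : TwoTwo lit) :
    (∃ M, PopularGen (EI lit) (rankI lit) prankI M) ↔
      ∃ σ : Fin n → Bool, ∀ i : Fin m, ∃ k : Fin 3,
        σ (lit i k).1 = (lit i k).2 := by
  refine ⟨fun ⟨M, hM⟩ => hM.exists_satisfying htwo, fun ⟨σ, hσ⟩ => ?_⟩
  choose choice hchoice using hσ
  exact ⟨Msat σ choice, popularGen_Msat htwo hchoice⟩
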